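/- arXiv:2509.22023 — 3 statements merged into one kernel-verified Lean document; each statement's English description precedes it below -/
import Mathlib

section
/- Let n ≥ 1, let D be a probability mass function on the nonempty subsets of Fin n, and let τ be any permutation of Fin n. Then there exists a probability vector π on Fin n such that ∑_S D(S) · (∑_{i ∈ S} π i)⁻¹ ≤ H_n · ∑_S D(S) · T_τ(S), where the inverse is interpreted in [0,∞]. In particular, the infimum over probability vectors π of the non-adaptive cost ∑_S D(S)/π(S) is at most H_n times the expected cover time of every permutation. -/
open Finset

/-- Cover time of a subset `S` under a permutation `τ`: the least `m ∈ {1,…,n}` such that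
`τ` applied to the `m`-th index lies in `S` (with value `0` if no such index exists,
which does not happen for nonempty `S`). -/
noncomputable def coverTime {n : ℕ} (τ : Equiv.Perm (Fin n)) (S : Finset (Fin n)) : ℕ :=
  sInf {m : ℕ | ∃ k : Fin n, τ k ∈ S ∧ m = (k : ℕ) + 1}

/-- For every pmf `D` on the nonempty subsets of `Fin n` and every permutation `τ`,
there is a probability vector `π` whose non-adaptive cost (with the inverse taken in `[0,∞]`)
is at most `H_n` times the expected cover time of `τ`. -/
theorem exists_prob_vector_cost_le_harmonic_mul_expected_cover_time
    (n : ℕ) (hn : 1 ≤ n)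
    (D : Finset (Fin n) → ℝ)
    (hD0 : ∀ S, 0 ≤ D S) (hDempty : D ∅ = 0)
    (hDsum : ∑ S : Finset (Fin n), D S = 1)
    (τ : Equiv.Perm (Fin n)) :
    ∃ π : Fin n → ℝ, (∀ i, 0 ≤ π i) ∧ (∑ i, π i) = 1 ∧
      ∑ S : Finset (Fin n),
          ENNReal.ofReal (D S) * (ENNReal.ofReal (∑ i ∈ S, π i))⁻¹
        ≤ ENNReal.ofReal
            ((∑ k ∈ Finset.range n, (1 : ℝ) / (k + 1)) *
              ∑ S : Finset (Fin n), D S * (coverTime τ S : ℝ)) := by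
  have hH : 0 < ∑ k ∈ Finset.range n, (1 : ℝ) / (k + 1) :=
    Finset.sum_pos (fun k _ => by positivity) ⟨0, Finset.mem_range.2 hn⟩
  set H : ℝ := ∑ k ∈ Finset.range n, (1 : ℝ) / (k + 1) with hHdef
  have hnn : ∀ i : Fin n, 0 ≤ 1 / ((((τ.symm i : Fin n) : ℕ) : ℝ) + 1) / H := fun i => by
    positivity
  refine ⟨fun i => 1 / ((((τ.symm i : Fin n) : ℕ) : ℝ) + 1) / H, hnn, ?_, ?_⟩
  · rw [Equiv.sum_comp τ.symm (fun k : Fin n => 1 / (((k : ℕ) : ℝ) + 1) / H),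
      ← Finset.sum_div, Fin.sum_univ_eq_sum_range (fun k : ℕ => 1 / ((k : ℝ) + 1)) n, ← hHdef,
      div_self hH.ne']
  · rw [Finset.mul_sum, ENNReal.ofReal_sum_of_nonneg
      (fun S _ => mul_nonneg hH.le (mul_nonneg (hD0 S) (Nat.cast_nonneg _)))]
    refine Finset.sum_le_sum fun S _ => ?_
    rcases S.eq_empty_or_nonempty with rfl | ⟨i, hi⟩
    · simp [hDempty]
    · have hne : {m : ℕ | ∃ k : Fin n, τ k ∈ S ∧ m = (k : ℕ) + 1}.Nonempty :=
        ⟨_, τ.symm i, by simpa using hi, rfl⟩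
      obtain ⟨k, hk, hm⟩ := Nat.sInf_mem hne
      have hT : coverTime τ S = (k : ℕ) + 1 := hm
      have hle : 1 / (((k : ℕ) : ℝ) + 1) / H
          ≤ ∑ i ∈ S, 1 / ((((τ.symm i : Fin n) : ℕ) : ℝ) + 1) / H := by
        have := Finset.single_le_sum (fun i _ => hnn i) hk
        simpa using this
      have hpos : 0 < 1 / (((k : ℕ) : ℝ) + 1) / H := by positivity
      rw [hT, mul_left_comm, ENNReal.ofReal_mul (hD0 S)]
      gcongr
      rw [← ENNReal.ofReal_inv_of_pos (hpos.trans_le hle)]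
      apply ENNReal.ofReal_le_ofReal
      refine (inv_anti₀ hpos hle).trans (le_of_eq ?_)
      push_cast
      field_simp
end

section
/- For n ≥ 2, let D_n be the probability mass function on subsets of Fin n assigning probability 2/3 to the set {1,…,n−1} and probability 1/3 to the singleton {n}. (a) Under D_n, every element i ≤ n−1 has marginal probability 2/3 of belonging to the random set S, while n has marginal probability 1/3; hence every permutation that orders elements by nonincreasing marginal probability places n last. (b) Every permutation τ of Fin n in which all of 1,…,n−1 precede n has expected cover time ∑_S D_n(S) · T_τ(S) = (n+2)/3. (c) Every permutation τ* with τ*(1) = 1 and τ*(2) = n has expected cover time 4/3. Consequently, ordering guesses by marginal probabilities costs at least (n+2)/4 times more than the optimal permutation. -/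
open Finset

theorem coverTime_eq_aux {n : ℕ} (τ : Equiv.Perm (Fin n)) (S : Finset (Fin n)) (k : Fin n)
    (hk : τ k ∈ S) (hlt : ∀ j : Fin n, j < k → τ j ∉ S) : coverTime τ S = (k : ℕ) + 1 := by
  unfold coverTime
  apply le_antisymm
  · exact Nat.sInf_le ⟨k, hk, rfl⟩
  · refine le_csInf ⟨_, k, hk, rfl⟩ ?_
    rintro b ⟨j, hj, rfl⟩
    by_contra hcon
    exact hlt j (by rw [Fin.lt_def]; omega) hj

theorem sum_D_aux (m : ℕ) (D : Finset (Fin (m + 2)) → ℝ)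
    (hD : ∀ S, D S =
      if S = Finset.univ.erase (Fin.last (m + 1)) then 2 / 3
      else if S = {Fin.last (m + 1)} then 1 / 3
      else 0) (f : Finset (Fin (m + 2)) → ℝ) :
    ∑ S : Finset (Fin (m + 2)), D S * f S =
      2 / 3 * f (Finset.univ.erase (Fin.last (m + 1))) + 1 / 3 * f {Fin.last (m + 1)} := by
  have hne : ({Fin.last (m + 1)} : Finset (Fin (m + 2))) ≠
      Finset.univ.erase (Fin.last (m + 1)) := by
    intro h
    have : Fin.last (m + 1) ∈ Finset.univ.erase (Fin.last (m + 1)) := by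
      rw [← h]; simp
    simp at this
  have h : ∀ S, D S * f S =
      (if S = Finset.univ.erase (Fin.last (m + 1)) then 2 / 3 * f S else 0)
      + (if S = {Fin.last (m + 1)} then 1 / 3 * f S else 0) := by
    intro S
    rw [hD]
    by_cases h1 : S = Finset.univ.erase (Fin.last (m + 1))
    · have h2 : S ≠ {Fin.last (m + 1)} := fun h => hne (h.symm.trans h1)
      rw [if_pos h1, if_pos h1, if_neg h2, add_zero]
    · rw [if_neg h1, if_neg h1]
      split_ifs <;> ring
  simp only [h, Finset.sum_add_distrib, Finset.sum_ite_eq', Finset.mem_univ, if_true]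

/-- The lower-bound example for marginal-based orderings: for `n = m + 2 ≥ 2`, let `D` put
probability `2/3` on the set of all elements except the last and `1/3` on the singleton of the
last element, and let `marg i` be the marginal probability that `i` lies in the random set. Then
(a) the marginals are `2/3` for non-last elements and `1/3` for the last one, so any permutation
ordered by nonincreasing marginals places the last element last; (b) any permutation placing the
last element last has expected cover time `(n+2)/3`; (c) any permutation starting with the first
element followed by the last element has expected cover time `4/3`; consequently any
marginal-ordered permutation costs at least `(n+2)/4` times such an optimal permutation. -/
theorem marginal_ordering_bad_example
    (m : ℕ)
    (D : Finset (Fin (m + 2)) → ℝ)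
    (hD : ∀ S, D S =
      if S = Finset.univ.erase (Fin.last (m + 1)) then 2 / 3
      else if S = {Fin.last (m + 1)} then 1 / 3
      else 0)
    (marg : Fin (m + 2) → ℝ)
    (hmarg : ∀ i, marg i =
      ∑ S ∈ Finset.univ.filter (fun S : Finset (Fin (m + 2)) => i ∈ S), D S) :
    -- (a) the marginals
    (∀ i : Fin (m + 2), i ≠ Fin.last (m + 1) → marg i = 2 / 3) ∧
    marg (Fin.last (m + 1)) = 1 / 3 ∧
    -- (a) ordering by nonincreasing marginals places the last element last
    (∀ τ : Equiv.Perm (Fin (m + 2)),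
      (∀ j k : Fin (m + 2), j ≤ k → marg (τ k) ≤ marg (τ j)) →
      τ (Fin.last (m + 1)) = Fin.last (m + 1)) ∧
    -- (b) expected cover time `(n+2)/3` when all other elements precede the last one
    (∀ τ : Equiv.Perm (Fin (m + 2)),
      (∀ k : Fin (m + 2), τ k = Fin.last (m + 1) → k = Fin.last (m + 1)) →
      ∑ S : Finset (Fin (m + 2)), D S * (coverTime τ S : ℝ)
        = (((m + 2 : ℕ) : ℝ) + 2) / 3) ∧
    -- (c) expected cover time `4/3` for permutations starting with the first, then the last element
    (∀ τ : Equiv.Perm (Fin (m + 2)),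
      τ 0 = 0 → τ 1 = Fin.last (m + 1) →
      ∑ S : Finset (Fin (m + 2)), D S * (coverTime τ S : ℝ) = 4 / 3) ∧
    -- consequence: marginal ordering costs at least `(n+2)/4` times the optimum
    (∀ τ τstar : Equiv.Perm (Fin (m + 2)),
      (∀ j k : Fin (m + 2), j ≤ k → marg (τ k) ≤ marg (τ j)) →
      τstar 0 = 0 → τstar 1 = Fin.last (m + 1) →
      (((m + 2 : ℕ) : ℝ) + 2) / 4
          * ∑ S : Finset (Fin (m + 2)), D S * (coverTime τstar S : ℝ)
        ≤ ∑ S : Finset (Fin (m + 2)), D S * (coverTime τ S : ℝ)) := by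
  have key := sum_D_aux m D hD
  have hm : ∀ i, marg i = 2 / 3 * (if i ∈ Finset.univ.erase (Fin.last (m + 1)) then 1 else 0)
      + 1 / 3 * (if i ∈ ({Fin.last (m + 1)} : Finset (Fin (m + 2))) then 1 else 0) := by
    intro i
    rw [hmarg, ← key (fun S => if i ∈ S then 1 else 0), Finset.sum_filter]
    refine Finset.sum_congr rfl fun S _ => ?_
    split_ifs <;> simp
  have ha : ∀ i : Fin (m + 2), i ≠ Fin.last (m + 1) → marg i = 2 / 3 := by
    intro i hi
    rw [hm]; simp [hi]
  have hl : marg (Fin.last (m + 1)) = 1 / 3 := by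
    rw [hm]; simp
  have hord : ∀ τ : Equiv.Perm (Fin (m + 2)),
      (∀ j k : Fin (m + 2), j ≤ k → marg (τ k) ≤ marg (τ j)) →
      τ (Fin.last (m + 1)) = Fin.last (m + 1) := by
    intro τ h
    by_contra hne
    have h1 := h (τ.symm (Fin.last (m + 1))) (Fin.last (m + 1)) (Fin.le_last _)
    rw [Equiv.apply_symm_apply, hl, ha _ hne] at h1
    norm_num at h1
  have hb : ∀ τ : Equiv.Perm (Fin (m + 2)),
      (∀ k : Fin (m + 2), τ k = Fin.last (m + 1) → k = Fin.last (m + 1)) →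
      ∑ S : Finset (Fin (m + 2)), D S * (coverTime τ S : ℝ)
        = (((m + 2 : ℕ) : ℝ) + 2) / 3 := by
    intro τ h
    have hτ : τ (Fin.last (m + 1)) = Fin.last (m + 1) := by
      have := h (τ.symm (Fin.last (m + 1))) (by simp)
      rw [Equiv.symm_apply_eq] at this
      exact this.symm
    have h0 : (0 : Fin (m + 2)) ≠ Fin.last (m + 1) := by
      intro h; simp [Fin.ext_iff] at h
    rw [key (fun S => (coverTime τ S : ℝ)),
      coverTime_eq_aux τ _ 0 (by simpa using fun h' => h0 (h 0 h'))
        (fun j hj => absurd hj (Fin.not_lt_zero j)),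
      coverTime_eq_aux τ {Fin.last (m + 1)} (Fin.last (m + 1)) (by simp [hτ])
        (fun j hj hj' => hj.ne (h j (by simpa using hj')))]
    simp
    ring
  have hc : ∀ τ : Equiv.Perm (Fin (m + 2)),
      τ 0 = 0 → τ 1 = Fin.last (m + 1) →
      ∑ S : Finset (Fin (m + 2)), D S * (coverTime τ S : ℝ) = 4 / 3 := by
    intro τ t0 t1
    have h0 : (0 : Fin (m + 2)) ≠ Fin.last (m + 1) := by
      intro h; simp [Fin.ext_iff] at h
    rw [key (fun S => (coverTime τ S : ℝ)),
      coverTime_eq_aux τ _ 0 (by rw [t0]; simpa using h0)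
        (fun j hj => absurd hj (Fin.not_lt_zero j)),
      coverTime_eq_aux τ {Fin.last (m + 1)} 1 (by simp [t1]) (by
        intro j hj hj'
        have : j = 0 := by
          rw [Fin.lt_def] at hj
          ext
          simp at hj ⊢
          simp [hj]
        rw [this, t0] at hj'
        exact h0 (by simpa using hj'))]
    simp
    norm_num
  refine ⟨ha, hl, hord, hb, hc, ?_⟩
  intro τ τs h h0 h1
  rw [hc τs h0 h1, hb τ (fun k hk => τ.injective (hk.trans (hord τ h).symm))]
  apply le_of_eq
  ring
end

section
/- For n ≥ 2, let D_n be the probability mass function on subsets of Fin n assigning probability 2/3 to the set {1,…,n−1} and probability 1/3 to the singleton {n}, and let π^CE be the probability vector proportional to the marginals of D_n, i.e. π^CE_i = 2/(2n−1) for i ≤ n−1 and π^CE_n = 1/(2n−1). Then the non-adaptive cost of π^CE equals (2/3)·(2n−1)/(2n−2) + (1/3)·(2n−1), which is at least (2n−1)/3, whereas the probability vector π' with π'_1 = π'_n = 1/2 and π'_i = 0 otherwise has non-adaptive cost exactly 2. Hence the marginal-proportional policy, which is what minimizing the cross-entropy loss produces, is at least (2n−1)/6 times costlier than an optimal non-adaptive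 policy. -/
open Finset
open scoped ENNReal

/-- On the example distribution (probability `2/3` on all-but-last, `1/3` on the last singleton,
with `n = m + 2 ≥ 2`), the marginal-proportional probability vector `π^CE` — which is what
minimizing the cross-entropy loss produces — has non-adaptive cost
`(2/3)·(2n−1)/(2n−2) + (1/3)·(2n−1) ≥ (2n−1)/3`, whereas the probability vector putting mass
`1/2` on the first and last elements has non-adaptive cost exactly `2`; hence `π^CE` is at least
`(2n−1)/6` times costlier than an optimal non-adaptive policy. -/
theorem crossEntropy_policy_costly_example
    (m : ℕ)
    (D : Finset (Fin (m + 2)) → ℝ)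
    (hD : ∀ S, D S =
      if S = Finset.univ.erase (Fin.last (m + 1)) then 2 / 3
      else if S = {Fin.last (m + 1)} then 1 / 3
      else 0)
    (πCE : Fin (m + 2) → ℝ)
    (hπCE : ∀ i, πCE i =
      if i = Fin.last (m + 1) then 1 / (2 * ((m + 2 : ℕ) : ℝ) - 1)
      else 2 / (2 * ((m + 2 : ℕ) : ℝ) - 1))
    (π' : Fin (m + 2) → ℝ)
    (hπ' : ∀ i, π' i = if i = 0 ∨ i = Fin.last (m + 1) then 1 / 2 else 0)
    (cost : (Fin (m + 2) → ℝ) → ℝ≥0∞)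
    (hcost : ∀ π, cost π = ∑ S : Finset (Fin (m + 2)),
      ENNReal.ofReal (D S) * (ENNReal.ofReal (∑ i ∈ S, π i))⁻¹) :
    -- `πCE` and `π'` are probability vectors
    (∀ i, 0 ≤ πCE i) ∧ (∑ i, πCE i) = 1 ∧
    (∀ i, 0 ≤ π' i) ∧ (∑ i, π' i) = 1 ∧
    -- the non-adaptive cost of `πCE`
    cost πCE = ENNReal.ofReal
      (2 / 3 * (2 * ((m + 2 : ℕ) : ℝ) - 1) / (2 * ((m + 2 : ℕ) : ℝ) - 2)
        + 1 / 3 * (2 * ((m + 2 : ℕ) : ℝ) - 1)) ∧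
    ENNReal.ofReal ((2 * ((m + 2 : ℕ) : ℝ) - 1) / 3) ≤ cost πCE ∧
    -- the non-adaptive cost of `π'`
    cost π' = 2 ∧
    -- hence `πCE` is at least `(2n−1)/6` times costlier than `π'`
    ENNReal.ofReal ((2 * ((m + 2 : ℕ) : ℝ) - 1) / 6) * cost π' ≤ cost πCE := by
  have hAB : (Finset.univ.erase (Fin.last (m + 1)) : Finset (Fin (m + 2))) ≠ {Fin.last (m + 1)} := by
    intro h
    have h1 : Fin.last (m + 1) ∈ ({Fin.last (m + 1)} : Finset (Fin (m + 2))) := by simp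
    rw [← h] at h1
    simp at h1
  have hn : (0 : ℝ) ≤ (m : ℝ) := Nat.cast_nonneg m
  have key : ∀ (π : Fin (m + 2) → ℝ) (a b : ℝ), 0 < a → 0 < b →
      ∑ i ∈ Finset.univ.erase (Fin.last (m + 1)), π i = a → π (Fin.last (m + 1)) = b →
      cost π = ENNReal.ofReal (2 / 3 * a⁻¹ + 1 / 3 * b⁻¹) := by
    intro π a b ha hb hA hB
    rw [hcost, ← Finset.sum_subset (Finset.subset_univ
      {Finset.univ.erase (Fin.last (m + 1)), {Fin.last (m + 1)}})]
    · rw [Finset.sum_pair hAB, hD, hD, if_pos rfl, if_neg hAB.symm, if_pos rfl, hA,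
        Finset.sum_singleton, hB, ← ENNReal.ofReal_inv_of_pos ha, ← ENNReal.ofReal_inv_of_pos hb,
        ← ENNReal.ofReal_mul (by norm_num), ← ENNReal.ofReal_mul (by norm_num),
        ← ENNReal.ofReal_add (by positivity) (by positivity)]
    · intro S _ hS
      simp only [Finset.mem_insert, Finset.mem_singleton, not_or] at hS
      rw [hD, if_neg hS.1, if_neg hS.2]
      simp
  have hlast' : π' (Fin.last (m + 1)) = 1 / 2 := by rw [hπ']; simp
  have hlastC : πCE (Fin.last (m + 1)) = 1 / (2 * ((m + 2 : ℕ) : ℝ) - 1) := by rw [hπCE]; simp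
  have hA' : ∑ i ∈ Finset.univ.erase (Fin.last (m + 1)), π' i = 1 / 2 := by
    rw [Finset.sum_eq_single (0 : Fin (m + 2))]
    · rw [hπ']; simp
    · intro i hi h0
      rw [hπ', if_neg]
      simp only [not_or]
      exact ⟨h0, Finset.ne_of_mem_erase hi⟩
    · intro h
      exfalso
      apply h
      simp [Fin.ext_iff]
  have hAC : ∑ i ∈ Finset.univ.erase (Fin.last (m + 1)), πCE i
      = (2 * ((m + 2 : ℕ) : ℝ) - 2) / (2 * ((m + 2 : ℕ) : ℝ) - 1) := by
    rw [Finset.sum_congr rfl (g := fun _ => 2 / (2 * ((m + 2 : ℕ) : ℝ) - 1))]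
    · rw [Finset.sum_const, Finset.card_erase_of_mem (Finset.mem_univ _), Finset.card_univ,
        Fintype.card_fin, nsmul_eq_mul]
      simp only [Nat.add_sub_cancel, show m + 2 - 1 = m + 1 from rfl]
      push_cast
      ring
    · intro i hi
      rw [hπCE, if_neg (Finset.ne_of_mem_erase hi)]
  have hp1 : (0 : ℝ) < 2 * ((m + 2 : ℕ) : ℝ) - 1 := by push_cast; linarith
  have hp2 : (0 : ℝ) < 2 * ((m + 2 : ℕ) : ℝ) - 2 := by push_cast; linarith
  have hC := key πCE _ _ (by positivity) (by positivity) hAC hlastC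
  have hC' := key π' _ _ (by positivity) (by positivity) hA' hlast'
  have hC2 : cost πCE = ENNReal.ofReal
      (2 / 3 * (2 * ((m + 2 : ℕ) : ℝ) - 1) / (2 * ((m + 2 : ℕ) : ℝ) - 2)
        + 1 / 3 * (2 * ((m + 2 : ℕ) : ℝ) - 1)) := by
    rw [hC, inv_div, inv_div, div_one, mul_div_assoc]
  have hC2' : cost π' = 2 := by
    rw [hC']
    norm_num
  have hle : ENNReal.ofReal ((2 * ((m + 2 : ℕ) : ℝ) - 1) / 3) ≤ cost πCE := by
    rw [hC2]
    apply ENNReal.ofReal_le_ofReal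
    have : 0 ≤ 2 / 3 * (2 * ((m + 2 : ℕ) : ℝ) - 1) / (2 * ((m + 2 : ℕ) : ℝ) - 2) := by positivity
    linarith
  refine ⟨?_, ?_, ?_, ?_, hC2, hle, hC2', ?_⟩
  · intro i
    rw [hπCE]
    split_ifs <;> positivity
  · rw [← Finset.sum_erase_add _ _ (Finset.mem_univ (Fin.last (m + 1))), hAC, hlastC, ← add_div,
      div_eq_one_iff_eq hp1.ne']
    ring
  · intro i
    rw [hπ']
    split_ifs <;> norm_num
  · rw [← Finset.sum_erase_add _ _ (Finset.mem_univ (Fin.last (m + 1))), hA', hlast']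
    norm_num
  · refine le_trans (le_of_eq ?_) hle
    rw [hC2', show (2 : ℝ≥0∞) = ENNReal.ofReal 2 by norm_num, ← ENNReal.ofReal_mul (by positivity)]
    congr 1
    ring
end
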